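/- (Pfaff-type recurrence for Jackson's ₈φ₇ sum) Let q be a nonzero complex number, let n ≥ 1 be an integer, and let a, b, c, d be nonzero complex numbers with a ≠ 1 such that all factors appearing in denominators below are nonzero: (q;q)_n ≠ 0, (aq/b;q)_{n+1} ≠ 0, (aq/c;q)_{n+1} ≠ 0, (aq/d;q)_{n+1} ≠ 0, (aq^{n−1};q)_{n+2} ≠ 0, and 1 − bcd q^{m}/a ≠ 0 for every integer m with −n ≤ m ≤ 2−n+(n−2). Define S_n(a,b,c,d;q) := ∑_{j=0}^{n} ( (a;q)_j · ((1−aq^{2j})/(1−a)) · (b;q)_j (c;q)_j (d;q)_j (a²q^{n+1}/(bcd);q)_j (q^{-n};q)_j / ((q;q)_j (aq/b;q)_j (aq/c;q)_j (aq/d;q)_j (bcd q^{-n}/a;q)_j (aq^{n+1};q)_j) ) · q^j. Then S_n(a,b,c,d;q) − S_{n−1}(a,b,c,d;q) = φ_n(a,b,c,d;q) · S_{n−1}(aq², bq, cq, dq; q), where φ_n(a,b,c,d;q) = − q(1−aq)(1−aq²)(1−b)(1−c)(1−d)·(q^{-n} − a²q^n/(bcd) + aq^n − bcd q^{-n}/a)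 / ((1−aq^n)(1−aq^{n+1})(1−aq/b)(1−aq/c)(1−aq/d)(1−bcd q^{-n}/a)(1−bcd q^{-n+1}/a)), and S_{n−1}(aq²,bq,cq,dq;q) is the same sum with a replaced by aq², each of b, c, d multiplied by q, and n replaced by n−1. -/

import Mathlib

/-- The $q$-shifted factorial $(a;q)_m = \prod_{k=0}^{m-1}(1 - a q^k)$. -/
noncomputable def qPoch (q a : ℂ) (m : ℕ) : ℂ := ∏ k ∈ Finset.range m, (1 - a * q ^ k)

/-- Jackson's terminating ${}_8\phi_7$ sum (root-free very-well-poised form,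
with the balanced choice $e = a^2 q^{n+1}/(bcd)$). -/
noncomputable def S87 (q a b c d : ℂ) (n : ℕ) : ℂ :=
  ∑ j ∈ Finset.range (n + 1),
    qPoch q a j * ((1 - a * q ^ (2 * j)) / (1 - a)) * qPoch q b j * qPoch q c j *
      qPoch q d j * qPoch q (a ^ 2 * q ^ (n + 1) / (b * c * d)) j *
      qPoch q (q ^ (-(n : ℤ))) j /
      (qPoch q q j * qPoch q (a * q / b) j * qPoch q (a * q / c) j * qPoch q (a * q / d) j *
        qPoch q (b * c * d * q ^ (-(n : ℤ)) / a) j * qPoch q (a * q ^ (n + 1)) j) * q ^ j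

lemma qPoch_succ (q a : ℂ) (m : ℕ) : qPoch q a (m + 1) = qPoch q a m * (1 - a * q ^ m) :=
  Finset.prod_range_succ _ _

lemma qPoch_succ' (q a : ℂ) (m : ℕ) : qPoch q a (m + 1) = (1 - a) * qPoch q (a * q) m := by
  simp only [qPoch, Finset.prod_range_succ', pow_zero, mul_one, mul_comm (1 - a)]
  congr 1
  exact Finset.prod_congr rfl fun k _ => by ring

lemma qPoch_ne_zero_iff {q a : ℂ} {m : ℕ} : qPoch q a m ≠ 0 ↔ ∀ k < m, 1 - a * q ^ k ≠ 0 := by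
  simp [qPoch, Finset.prod_ne_zero_iff]

/-- The very-well-poised factor `(1 - a q^(2k)) / (1 - a)` may be cleared even when `a = 1`. -/
lemma qPoch_mul_wellPoised (q a : ℂ) (k : ℕ) :
    (1 - a) * (qPoch q a k * ((1 - a * q ^ (2 * k)) / (1 - a))) =
      qPoch q a k * (1 - a * q ^ (2 * k)) := by
  by_cases h : 1 - a = 0
  · cases k with
    | zero => simp [h]
    | succ k => simp [qPoch_succ', h]
  · field_simp

/-- The factors of the `j`-th summand of `S87 q a b c d n` that depend on `n`, with `u = b c d / a`
and `N = q ^ n`. -/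
noncomputable def nPart (q a u N : ℂ) (j : ℕ) : ℂ :=
  qPoch q (a * q * N / u) j * qPoch q N⁻¹ j / (qPoch q (u / N) j * qPoch q (a * q * N) j)

/-- The factors of the `j`-th summand of `S87 q a b c d n` that do not depend on `n`. -/
noncomputable def freePart (q a b c d : ℂ) (j : ℕ) : ℂ :=
  qPoch q a j * ((1 - a * q ^ (2 * j)) / (1 - a)) * qPoch q b j * qPoch q c j * qPoch q d j /
    (qPoch q q j * qPoch q (a * q / b) j * qPoch q (a * q / c) j * qPoch q (a * q / d) j) * q ^ j

lemma S87_eq_sum (q a b c d : ℂ) (n : ℕ) :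
    S87 q a b c d n =
      ∑ j ∈ Finset.range (n + 1),
        freePart q a b c d j * nPart q a (b * c * d / a) (q ^ n) j := by
  have he : a ^ 2 * q ^ (n + 1) / (b * c * d) = a * q * q ^ n / (b * c * d / a) := by
    rw [div_div_eq_mul_div]; ring
  have hu : b * c * d * q ^ (-(n : ℤ)) / a = b * c * d / a / q ^ n := by
    rw [zpow_neg, zpow_natCast]; ring
  have hA : a * q ^ (n + 1) = a * q * q ^ n := by ring
  have hN : q ^ (-(n : ℤ)) = (q ^ n)⁻¹ := by rw [zpow_neg, zpow_natCast]
  refine Finset.sum_congr rfl fun j _ => ?_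
  rw [he, hu, hA, hN, nPart, freePart]
  ring

lemma nPart_sub {q a u N : ℂ} (hq : q ≠ 0) (hu : u ≠ 0) (hN : N ≠ 0) (k : ℕ)
    (hU : ∀ i ≤ k + 1, 1 - u / N * q ^ i ≠ 0) (hA : ∀ i ≤ k + 1, 1 - a * N * q ^ i ≠ 0) :
    nPart q a u N (k + 1) - nPart q a u (N / q) (k + 1) =
      -((1 - q ^ (k + 1)) * (1 - a * q ^ (k + 1)) * (N⁻¹ - a * N / u + a * N - u / N)) /
        ((1 - a * N) * (1 - a * N * q) * (1 - u / N) * (1 - u / N * q)) *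
        nPart q (a * q ^ 2) (u * q) (N / q) k := by
  have hU0 : 1 - u / N ≠ 0 := by simpa using hU 0 (by omega)
  have hU1 : 1 - u / N * q ≠ 0 := by simpa using hU 1 (by omega)
  have hUk := hU (k + 1) le_rfl
  have hA0 : 1 - a * N ≠ 0 := by simpa using hA 0 (by omega)
  have hA1 : 1 - a * N * q ≠ 0 := by simpa using hA 1 (by omega)
  have hAk := hA (k + 1) le_rfl
  have hPU : qPoch q (u / N * q * q) k ≠ 0 := qPoch_ne_zero_iff.2 fun i hi => by
    convert hU (i + 2) (by omega) using 2; ring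
  have hPA : qPoch q (a * N * q * q) k ≠ 0 := qPoch_ne_zero_iff.2 fun i hi => by
    convert hA (i + 2) (by omega) using 2; ring
  have hNk : nPart q a u N (k + 1) =
      qPoch q (a * N * q / u) k * qPoch q (q / N) k *
        ((1 - a * N * q / u * q ^ k) * (1 - N⁻¹) * (1 - u / N * q ^ (k + 1))) /
        ((1 - u / N) * (1 - u / N * q) * (1 - a * N * q) *
          (qPoch q (u / N * q * q) k * qPoch q (a * N * q * q) k)) := by
    have hP : qPoch q (u / N) (k + 1) =
        (1 - u / N) * ((1 - u / N * q) * qPoch q (u / N * q * q) k) /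
          (1 - u / N * q ^ (k + 1)) := by
      rw [eq_div_iff hUk, ← qPoch_succ, qPoch_succ', qPoch_succ']
    rw [nPart, hP, qPoch_succ, qPoch_succ', qPoch_succ', inv_mul_eq_div,
      mul_right_comm a q N]
    field_simp
  have hNk' : nPart q a u (N / q) (k + 1) =
      qPoch q (a * N * q / u) k * qPoch q (q / N) k *
        ((1 - a * N / u) * (1 - q / N * q ^ k) * (1 - a * N * q ^ (k + 1))) /
        ((1 - u / N * q) * (1 - a * N) * (1 - a * N * q) *
          (qPoch q (u / N * q * q) k * qPoch q (a * N * q * q) k)) := by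
    have hP : qPoch q (a * N) (k + 1) =
        (1 - a * N) * ((1 - a * N * q) * qPoch q (a * N * q * q) k) /
          (1 - a * N * q ^ (k + 1)) := by
      rw [eq_div_iff hAk, ← qPoch_succ, qPoch_succ', qPoch_succ']
    have h1 : a * q * (N / q) = a * N := by field_simp
    have h2 : u / (N / q) = u / N * q := by field_simp
    have h3 : a * N / u * q = a * N * q / u := by ring
    rw [nPart, h1, h2, inv_div, hP, qPoch_succ', qPoch_succ, qPoch_succ', h3]
    field_simp
  have hR : nPart q (a * q ^ 2) (u * q) (N / q) k =
      qPoch q (a * N * q / u) k * qPoch q (q / N) k /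
        (qPoch q (u / N * q * q) k * qPoch q (a * N * q * q) k) := by
    have h1 : a * q ^ 2 * q * (N / q) = a * N * q * q := by field_simp
    have h2 : u * q / (N / q) = u / N * q * q := by field_simp
    have h3 : a * N * q * q / (u * q) = a * N * q / u := by field_simp
    rw [nPart, h1, h2, inv_div, h3]
  rw [hNk, hNk', hR]
  generalize qPoch q (u / N * q * q) k = PU at *
  generalize qPoch q (a * N * q * q) k = PA at *
  generalize qPoch q (a * N * q / u) k = PE
  generalize qPoch q (q / N) k = PN
  have key : (1 - a * N * q / u * q ^ k) * (1 - N⁻¹) * (1 - u / N * q ^ (k + 1)) * (1 - a * N) -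
      (1 - a * N / u) * (1 - q / N * q ^ k) * (1 - a * N * q ^ (k + 1)) * (1 - u / N) =
      -((1 - q ^ (k + 1)) * (1 - a * q ^ (k + 1)) * (N⁻¹ - a * N / u + a * N - u / N)) := by
    field_simp
    ring
  rw [← key]
  generalize 1 - u / N = U0 at *
  generalize 1 - u / N * q = U1 at *
  generalize 1 - a * N = A0 at *
  generalize 1 - a * N * q = A1 at *
  field_simp

lemma freePart_succ {q a b c d : ℂ} (hq : q ≠ 0) (ha1 : a ≠ 1) (k : ℕ)
    (h1 : 1 - q ^ (k + 1) ≠ 0) :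
    freePart q a b c d (k + 1) * ((1 - q ^ (k + 1)) * (1 - a * q ^ (k + 1))) =
      q * (1 - a * q) * (1 - a * q ^ 2) * (1 - b) * (1 - c) * (1 - d) /
        ((1 - a * q / b) * (1 - a * q / c) * (1 - a * q / d)) *
        freePart q (a * q ^ 2) (b * q) (c * q) (d * q) k := by
  have ha1' : 1 - a ≠ 0 := sub_ne_zero.2 ha1.symm
  have hw := qPoch_mul_wellPoised q (a * q ^ 2) k
  have hx : a * q ^ 2 * q ^ (2 * k) = a * q ^ (2 * (k + 1)) := by ring
  have haa : qPoch q a (k + 1) * (1 - a * q ^ (k + 1)) =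
      (1 - a) * ((1 - a * q) * qPoch q (a * q ^ 2) k) := by
    rw [← qPoch_succ, qPoch_succ', qPoch_succ', mul_assoc a q q, ← pow_two]
  have hqq : qPoch q q (k + 1) = qPoch q q k * (1 - q ^ (k + 1)) := by
    rw [qPoch_succ, pow_succ']
  have hden (z : ℂ) : qPoch q (a * q / z) (k + 1) =
      (1 - a * q / z) * qPoch q (a * q ^ 2 * q / (z * q)) k := by
    rw [qPoch_succ']; congr 2; field_simp
  rw [hx] at hw
  simp only [freePart, hqq, hden, hx, qPoch_succ' q b, qPoch_succ' q c, qPoch_succ' q d]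
  trans (qPoch q a (k + 1) * (1 - a * q ^ (k + 1))) / (1 - a) * (1 - a * q ^ (2 * (k + 1))) *
    ((1 - b) * qPoch q (b * q) k * ((1 - c) * qPoch q (c * q) k) *
      ((1 - d) * qPoch q (d * q) k)) /
    (qPoch q q k * ((1 - a * q / b) * qPoch q (a * q ^ 2 * q / (b * q)) k) *
      ((1 - a * q / c) * qPoch q (a * q ^ 2 * q / (c * q)) k) *
      ((1 - a * q / d) * qPoch q (a * q ^ 2 * q / (d * q)) k)) * q ^ (k + 1)
  · generalize 1 - q ^ (k + 1) = y at *
    refine Eq.trans ?_ (mul_inv_cancel_right₀ h1 _)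
    simp only [div_eq_mul_inv, mul_inv]
    ring
  · rw [haa, mul_div_cancel_left₀ _ ha1', mul_assoc (1 - a * q), ← hw]
    simp only [div_eq_mul_inv, mul_inv]
    ring

/-- Pfaff-type recurrence for Jackson's ${}_8\phi_7$ sum. -/
theorem jackson_recurrence (q : ℂ) (hq : q ≠ 0) (n : ℕ) (hn : 1 ≤ n) (a b c d : ℂ)
    (ha : a ≠ 0) (hb : b ≠ 0) (hc : c ≠ 0) (hd : d ≠ 0) (ha1 : a ≠ 1)
    (h1 : qPoch q q n ≠ 0) (h2 : qPoch q (a * q / b) (n + 1) ≠ 0)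
    (h3 : qPoch q (a * q / c) (n + 1) ≠ 0) (h4 : qPoch q (a * q / d) (n + 1) ≠ 0)
    (h5 : qPoch q (a * q ^ ((n : ℤ) - 1)) (n + 2) ≠ 0)
    (h6 : ∀ m : ℤ, -(n : ℤ) ≤ m → m ≤ 0 → 1 - b * c * d * q ^ m / a ≠ 0) :
    S87 q a b c d n - S87 q a b c d (n - 1)
      = -(q * (1 - a * q) * (1 - a * q ^ 2) * (1 - b) * (1 - c) * (1 - d) *
            (q ^ (-(n : ℤ)) - a ^ 2 * q ^ n / (b * c * d) + a * q ^ n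
              - b * c * d * q ^ (-(n : ℤ)) / a) /
          ((1 - a * q ^ n) * (1 - a * q ^ (n + 1)) * (1 - a * q / b) * (1 - a * q / c) *
            (1 - a * q / d) * (1 - b * c * d * q ^ (-(n : ℤ)) / a) *
            (1 - b * c * d * q ^ (1 - (n : ℤ)) / a)))
          * S87 q (a * q ^ 2) (b * q) (c * q) (d * q) (n - 1) := by
  obtain ⟨m, rfl⟩ : ∃ m, n = m + 1 := ⟨n - 1, by omega⟩
  have hu : b * c * d / a ≠ 0 := by positivity
  have hN : q ^ (m + 1) ≠ 0 := pow_ne_zero _ hq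
  have hNq : q ^ m = q ^ (m + 1) / q := by rw [pow_succ, mul_div_cancel_right₀ _ hq]
  have hU : ∀ i ≤ m + 1, 1 - b * c * d / a / q ^ (m + 1) * q ^ i ≠ 0 := fun i hi => by
    convert h6 (i - ((m + 1 : ℕ) : ℤ)) (by omega) (by omega) using 2
    rw [zpow_sub₀ hq, zpow_natCast, zpow_natCast]
    ring
  have hA : ∀ i ≤ m + 1, 1 - a * q ^ (m + 1) * q ^ i ≠ 0 := fun i hi => by
    convert qPoch_ne_zero_iff.1 h5 (i + 1) (by omega) using 2
    rw [Nat.cast_succ, add_sub_cancel_right, zpow_natCast]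
    ring
  have hQ : ∀ k ≤ m, 1 - q ^ (k + 1) ≠ 0 := fun k hk => by
    convert qPoch_ne_zero_iff.1 h1 k (by omega) using 2
    ring
  have hlast : nPart q a (b * c * d / a) (q ^ m) (m + 1) = 0 := by
    have : qPoch q (q ^ m)⁻¹ (m + 1) = 0 := by simp [qPoch_succ, hq]
    simp [nPart, this]
  have hu' : b * q * (c * q) * (d * q) / (a * q ^ 2) = b * c * d / a * q := by field_simp
  have hz : q ^ (-((m + 1 : ℕ) : ℤ)) = (q ^ (m + 1))⁻¹ := by rw [zpow_neg, zpow_natCast]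
  have hz' : q ^ (1 - ((m + 1 : ℕ) : ℤ)) = (q ^ (m + 1))⁻¹ * q := by
    rw [sub_eq_add_neg, zpow_add₀ hq, hz, zpow_one, mul_comm]
  have hS : S87 q a b c d m = ∑ j ∈ Finset.range (m + 2),
      freePart q a b c d j * nPart q a (b * c * d / a) (q ^ m) j := by
    rw [Finset.sum_range_succ, hlast, mul_zero, add_zero, S87_eq_sum]
  rw [Nat.add_sub_cancel, hS, S87_eq_sum, S87_eq_sum,
    ← Finset.sum_sub_distrib, Finset.sum_range_succ', Finset.mul_sum, hu']
  have h0 (N : ℂ) : nPart q a (b * c * d / a) N 0 = 1 := by simp [nPart, qPoch]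
  rw [h0, h0, sub_self, add_zero]
  refine Finset.sum_congr rfl fun k hk => ?_
  have hk : k ≤ m := Nat.lt_succ_iff.1 (Finset.mem_range.1 hk)
  rw [← mul_sub, hNq, nPart_sub hq hu hN k (fun i hi => hU i (by omega))
    (fun i hi => hA i (by omega))]
  have hf := freePart_succ (b := b) (c := c) (d := d) hq ha1 k (hQ k hk)
  generalize nPart q (a * q ^ 2) (b * c * d / a * q) (q ^ (m + 1) / q) k = Y
  trans (freePart q a b c d (k + 1) * ((1 - q ^ (k + 1)) * (1 - a * q ^ (k + 1)))) *
      -((q ^ (m + 1))⁻¹ - a * q ^ (m + 1) / (b * c * d / a) + a * q ^ (m + 1) -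
        b * c * d / a / q ^ (m + 1)) /
      ((1 - a * q ^ (m + 1)) * (1 - a * q ^ (m + 1) * q) *
        (1 - b * c * d / a / q ^ (m + 1)) * (1 - b * c * d / a / q ^ (m + 1) * q)) * Y
  · ring
  have e1 : a * q ^ (m + 1) / (b * c * d / a) = a ^ 2 * q ^ (m + 1) / (b * c * d) := by
    rw [div_div_eq_mul_div]; ring
  have e2 : b * c * d / a / q ^ (m + 1) = b * c * d * (q ^ (m + 1))⁻¹ / a := by ring
  have e3 : b * c * d * (q ^ (m + 1))⁻¹ / a * q = b * c * d * ((q ^ (m + 1))⁻¹ * q) / a := by ring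
  have e4 : a * q ^ (m + 1) * q = a * q ^ (m + 1 + 1) := by ring
  rw [hf, hz, hz', e1, e2, e3, e4]
  generalize freePart q (a * q ^ 2) (b * q) (c * q) (d * q) k = X
  simp only [div_eq_mul_inv, mul_inv]
  ring
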